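/- Let F be a number field, 𝔞 and 𝔟 nonzero fractional ideals of 𝒪_F in F, H = 𝔟 ⊕ 𝔞 the 𝒪_F-submodule of F ⊕ F with 𝔟 in the first coordinate and 𝔞 in the second, and g = [[a,b],[c,d]] ∈ GL₂(F). Then the lattice g^t(H) = 𝔟·(a,b) + 𝔞·(c,d) satisfies: (i) its image under the projection to the first coordinate is the fractional ideal a𝔟 + c𝔞; (ii) its intersection with 0 ⊕ F, identified with a fractional ideal of F via the second coordinate, equals det(g)·𝔟𝔞·(a𝔟 + c𝔞)^{-1}. -/

import Mathlib

open Function NumberField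

/-- For `u, v ∈ F`, the `𝒪_F`-linear map `F → F ⊕ F`, `x ↦ (u·x, v·x)`; the image of a
fractional ideal `𝔠` under this map is the module `𝔠·(u, v) ⊆ F ⊕ F`. -/
def rowMap (F : Type*) [Field F] [NumberField F] (u v : F) :
    F →ₗ[RingOfIntegers F] F × F where
  toFun x := (u * x, v * x)
  map_add' x y := by simp [mul_add, Prod.ext_iff]
  map_smul' r x := by
    simp [Prod.ext_iff, mul_smul_comm]

open FractionalIdeal in
/-- An element `s` lies in `𝔟𝔞(a𝔟 + c𝔞)⁻¹` if and only if `s * a ∈ 𝔞` and `s * c ∈ 𝔟`. -/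
theorem mem_mul_mul_inv_add_iff {R K : Type*} [CommRing R] [IsDedekindDomain R] [Field K]
    [Algebra R K] [IsFractionRing R K] {𝔞 𝔟 : FractionalIdeal (nonZeroDivisors R) K}
    (h𝔞 : 𝔞 ≠ 0) (h𝔟 : 𝔟 ≠ 0) {a c : K} (hac : a ≠ 0 ∨ c ≠ 0) (s : K) :
    s ∈ 𝔟 * 𝔞 * (spanSingleton (nonZeroDivisors R) a * 𝔟 +
        spanSingleton (nonZeroDivisors R) c * 𝔞)⁻¹ ↔ s * a ∈ 𝔞 ∧ s * c ∈ 𝔟 := by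
  have hJ : spanSingleton (nonZeroDivisors R) a * 𝔟 +
      spanSingleton (nonZeroDivisors R) c * 𝔞 ≠ 0 := by
    intro h
    rw [← FractionalIdeal.bot_eq_zero, ← sup_eq_add, sup_eq_bot_iff, FractionalIdeal.bot_eq_zero, mul_eq_zero, mul_eq_zero,
      spanSingleton_eq_zero_iff, spanSingleton_eq_zero_iff] at h
    tauto
  rw [← spanSingleton_le_iff_mem, ← mul_le_mul_iff_left₀ (pos_iff_ne_zero.2 hJ), mul_assoc (𝔟 * 𝔞), inv_mul_cancel₀ hJ,
    mul_one, mul_add, ← sup_eq_add, sup_le_iff, ← mul_assoc, ← mul_assoc,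
    spanSingleton_mul_spanSingleton, spanSingleton_mul_spanSingleton, mul_comm 𝔟 𝔞,
    mul_le_mul_iff_left₀ (pos_iff_ne_zero.2 h𝔟), mul_comm 𝔞 𝔟, mul_le_mul_iff_left₀ (pos_iff_ne_zero.2 h𝔞), spanSingleton_le_iff_mem,
    spanSingleton_le_iff_mem]

/-- the computation in the proof of Lemma `lem:normalize`.  Let `F` be
a number field, `𝔞` and `𝔟` nonzero fractional ideals of `𝒪_F` in `F`,
`H = 𝔟 ⊕ 𝔞 ⊆ F ⊕ F` (`𝔟` in the first coordinate, `𝔞` in the second), and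
`g = [[a,b],[c,d]] ∈ GL₂(F)`.  Then the lattice `g^t(H) = 𝔟·(a,b) + 𝔞·(c,d)` satisfies:
(i) its image under the projection to the first coordinate is the fractional ideal
`a𝔟 + c𝔞`; (ii) its intersection with `0 ⊕ F`, identified with a fractional ideal of `F`
via the second coordinate, equals `det(g)·𝔟𝔞·(a𝔟 + c𝔞)^{-1}`. -/
theorem lattice_transversal_computation
    (F : Type) [Field F] [NumberField F]
    (𝔞 𝔟 : FractionalIdeal (nonZeroDivisors (RingOfIntegers F)) F)
    (h𝔞 : 𝔞 ≠ 0) (h𝔟 : 𝔟 ≠ 0)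
    (a b c d : F) (hdet : a * d - b * c ≠ 0) :
    -- the lattice g^t(H) = 𝔟·(a,b) + 𝔞·(c,d) inside F ⊕ F
    ∀ gtH : Submodule (RingOfIntegers F) (F × F),
      gtH = Submodule.map (rowMap F a b) (𝔟 : Submodule (RingOfIntegers F) F) ⊔
            Submodule.map (rowMap F c d) (𝔞 : Submodule (RingOfIntegers F) F) →
      -- (i) the projection of g^t(H) to the first coordinate is a𝔟 + c𝔞
      (Submodule.map (LinearMap.fst (RingOfIntegers F) F F) gtH =
        ((FractionalIdeal.spanSingleton (nonZeroDivisors (RingOfIntegers F)) a * 𝔟 +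
          FractionalIdeal.spanSingleton (nonZeroDivisors (RingOfIntegers F)) c * 𝔞 :
          FractionalIdeal (nonZeroDivisors (RingOfIntegers F)) F) :
          Submodule (RingOfIntegers F) F)) ∧
      -- (ii) g^t(H) ∩ (0 ⊕ F), viewed in the second coordinate, is
      --      det(g)·𝔟𝔞·(a𝔟 + c𝔞)⁻¹
      (Submodule.map (LinearMap.snd (RingOfIntegers F) F F)
          (gtH ⊓ LinearMap.ker (LinearMap.fst (RingOfIntegers F) F F)) =
        ((FractionalIdeal.spanSingleton (nonZeroDivisors (RingOfIntegers F))
            (a * d - b * c) * (𝔟 * 𝔞) *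
          (FractionalIdeal.spanSingleton (nonZeroDivisors (RingOfIntegers F)) a * 𝔟 +
            FractionalIdeal.spanSingleton (nonZeroDivisors (RingOfIntegers F)) c * 𝔞)⁻¹ :
          FractionalIdeal (nonZeroDivisors (RingOfIntegers F)) F) :
          Submodule (RingOfIntegers F) F)) := by
  rintro _ rfl
  constructor
  · ext x
    simp only [Submodule.map_sup, ← Submodule.map_comp, Submodule.mem_sup, Submodule.mem_map,
      FractionalIdeal.coe_add, FractionalIdeal.mem_coe, Submodule.add_eq_sup,
      FractionalIdeal.mem_singleton_mul]
    constructor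
    · rintro ⟨_, ⟨y, hy, rfl⟩, _, ⟨z, hz, rfl⟩, rfl⟩
      exact ⟨_, ⟨y, hy, rfl⟩, _, ⟨z, hz, rfl⟩, rfl⟩
    · rintro ⟨_, ⟨y, hy, rfl⟩, _, ⟨z, hz, rfl⟩, rfl⟩
      exact ⟨_, ⟨y, hy, rfl⟩, _, ⟨z, hz, rfl⟩, rfl⟩
  · have hac : a ≠ 0 ∨ c ≠ 0 := by
      by_contra! h
      simp [h.1, h.2] at hdet
    ext x
    rw [FractionalIdeal.mem_coe, mul_assoc, FractionalIdeal.mem_singleton_mul]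
    simp only [mem_mul_mul_inv_add_iff h𝔞 h𝔟 hac, Submodule.mem_map, Submodule.mem_inf,
      Submodule.mem_sup, LinearMap.mem_ker]
    constructor
    · rintro ⟨_, ⟨⟨_, ⟨y, hy, rfl⟩, _, ⟨z, hz, rfl⟩, rfl⟩, h0⟩, rfl⟩
      replace h0 : a * y + c * z = 0 := h0
      have hs : (b * y + d * z) / (a * d - b * c) * a = z := by
        rw [div_mul_eq_mul_div, div_eq_iff hdet]
        linear_combination b * h0
      have ht : (b * y + d * z) / (a * d - b * c) * c = -y := by
        rw [div_mul_eq_mul_div, div_eq_iff hdet]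
        linear_combination d * h0
      refine ⟨(b * y + d * z) / (a * d - b * c), ⟨by rwa [hs], by rw [ht]; exact Submodule.neg_mem _ hy⟩, ?_⟩
      exact (mul_div_cancel₀ _ hdet).symm
    · rintro ⟨s, ⟨hsa, hsc⟩, rfl⟩
      refine ⟨_, ⟨⟨_, ⟨-(s * c), Submodule.neg_mem _ hsc, rfl⟩, _, ⟨s * a, hsa, rfl⟩, rfl⟩, ?_⟩, ?_⟩
      · change a * -(s * c) + c * (s * a) = 0
        ring
      · change b * -(s * c) + d * (s * a) = (a * d - b * c) * s
        ring
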